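/- Suppose the pair predictor p̂₂ is pair-calibrated with grouping function Φ. Then for every x ∈ 𝒳 and y ∈ 𝒴, the conditional mean squared error of the marginal prediction over the equivalence class equals the cheat-corrected epistemic variance: E[(p̂₁(y|x) − p(y|X))² | X ∈ [x]_Φ] = V̂(y|x). -/

import Mathlib

open Finset

open scoped Classical

/-- Conditional expectation of `f(X)` given `X ∈ [x]_Φ`, where `X ∼ μ` on a finite set. -/
noncomputable def groupExp {𝒳 𝒵 : Type*} [Fintype 𝒳] (μ : 𝒳 → ℝ) (Φ : 𝒳 → 𝒵)
    (f : 𝒳 → ℝ) (x : 𝒳) : ℝ :=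
  (∑ x' : 𝒳, if Φ x' = Φ x then μ x' * f x' else 0) /
  (∑ x' : 𝒳, if Φ x' = Φ x then μ x' else 0)

/-- Marginal `p̂₁(y|x) = ∑_{y'} p̂₂(y,y'|x)` of a pair predictor. -/
noncomputable def marginal {𝒳 𝒴 : Type*} [Fintype 𝒴] (p2 : 𝒳 → 𝒴 → 𝒴 → ℝ) (x : 𝒳) (y : 𝒴) : ℝ :=
  ∑ y' : 𝒴, p2 x y y'

/-- Cheat-corrected epistemic variance `V̂(y|x) = p̂₂(y,y|x) − p̂₁(y|x)²`. -/
noncomputable def cheatVar {𝒳 𝒴 : Type*} [Fintype 𝒴] (p2 : 𝒳 → 𝒴 → 𝒴 → ℝ) (x : 𝒳) (y : 𝒴) : ℝ :=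
  p2 x y y - (marginal p2 x y) ^ 2

/-- Cheat-corrected epistemic confidence `C(y|x)`. -/
noncomputable def cheatConf {𝒳 𝒴 : Type*} [Fintype 𝒴] (p2 : 𝒳 → 𝒴 → 𝒴 → ℝ) (x : 𝒳) (y : 𝒴) : ℝ :=
  if 0 < p2 x y y then (marginal p2 x y) ^ 2 / p2 x y y else 0


section GroupExp

variable {𝒳 𝒵 : Type*} [Fintype 𝒳] (μ : 𝒳 → ℝ) (Φ : 𝒳 → 𝒵)

theorem groupExp_add (f g : 𝒳 → ℝ) (x : 𝒳) :
    groupExp μ Φ (fun x' => f x' + g x') x = groupExp μ Φ f x + groupExp μ Φ g x := by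
  simp only [groupExp, ← Finset.sum_filter, mul_add, Finset.sum_add_distrib, add_div]

theorem groupExp_const_mul (c : ℝ) (f : 𝒳 → ℝ) (x : 𝒳) :
    groupExp μ Φ (fun x' => c * f x') x = c * groupExp μ Φ f x := by
  simp only [groupExp, ← Finset.sum_filter, mul_left_comm _ c, ← Finset.mul_sum, mul_div_assoc]

theorem groupExp_sum {ι : Type*} (s : Finset ι) (f : ι → 𝒳 → ℝ) (x : 𝒳) :
    groupExp μ Φ (fun x' => ∑ i ∈ s, f i x') x = ∑ i ∈ s, groupExp μ Φ (f i) x := by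
  simp only [groupExp, ← Finset.sum_filter, Finset.mul_sum, ← Finset.sum_div]
  rw [Finset.sum_comm]

theorem groupExp_const (hμ : ∀ x, 0 < μ x) (c : ℝ) (x : 𝒳) :
    groupExp μ Φ (fun _ => c) x = c := by
  simp only [groupExp, ← Finset.sum_filter, ← Finset.sum_mul]
  exact mul_div_cancel_left₀ c
    (Finset.sum_pos (fun i _ => hμ i) ⟨x, by simp⟩).ne'

end GroupExp

/-- The marginal of a pair-calibrated predictor is first-order calibrated. -/
theorem marginal_eq_groupExp {𝒳 𝒴 𝒵 : Type*} [Fintype 𝒳] [Fintype 𝒴] (μ : 𝒳 → ℝ)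
    (p : 𝒳 → 𝒴 → ℝ) (hp1 : ∀ x, ∑ y, p x y = 1) (p2 : 𝒳 → 𝒴 → 𝒴 → ℝ) (Φ : 𝒳 → 𝒵)
    (hcal : ∀ x y₁ y₂, p2 x y₁ y₂ = groupExp μ Φ (fun x' => p x' y₁ * p x' y₂) x)
    (x : 𝒳) (y : 𝒴) : marginal p2 x y = groupExp μ Φ (fun x' => p x' y) x := by
  simp only [marginal, hcal, ← groupExp_sum, ← Finset.mul_sum, hp1, mul_one]

/-- For a pair-calibrated pair predictor, the conditional mean squared
error of the marginal prediction over the equivalence class equals the cheat-corrected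
epistemic variance. -/
theorem stmt_5 {𝒳 𝒴 𝒵 : Type*} [Fintype 𝒳] [Fintype 𝒴] [Nonempty 𝒳] [Nonempty 𝒴]
    (μ : 𝒳 → ℝ) (hμpos : ∀ x, 0 < μ x) (hμsum : ∑ x, μ x = 1)
    (p : 𝒳 → 𝒴 → ℝ) (hp0 : ∀ x y, 0 ≤ p x y) (hp1 : ∀ x, ∑ y, p x y = 1)
    (p2 : 𝒳 → 𝒴 → 𝒴 → ℝ)
    (hp20 : ∀ x y₁ y₂, 0 ≤ p2 x y₁ y₂) (hp21 : ∀ x, ∑ y₁, ∑ y₂, p2 x y₁ y₂ = 1)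
    (Φ : 𝒳 → 𝒵)
    (hcal : ∀ x y₁ y₂, p2 x y₁ y₂ = groupExp μ Φ (fun x' => p x' y₁ * p x' y₂) x) :
    ∀ x y, groupExp μ Φ (fun x' => (marginal p2 x y - p x' y) ^ 2) x = cheatVar p2 x y := by
  intro x y
  have hsq : (fun x' => (marginal p2 x y - p x' y) ^ 2) = fun x' =>
      marginal p2 x y ^ 2 + (-2 * marginal p2 x y * p x' y + p x' y * p x' y) := by
    ext x'
    ring
  rw [hsq, groupExp_add, groupExp_add, groupExp_const μ Φ hμpos, groupExp_const_mul,
    ← marginal_eq_groupExp μ p hp1 p2 Φ hcal, ← hcal, cheatVar]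
  ring
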